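/- arXiv:1309.6076 — 2 statements merged into one kernel-verified Lean document; each statement's English description precedes it below -/
import Mathlib

section
/- Let k ≥ 1 and let X : ℝⁿ × ℝⁿ → ℝⁿ × ℝⁿ be a C^{k+1} vector field with X(x+m, p) = X(x, p) for all m ∈ ℤⁿ, generating a complete flow (φ̃_t). Let K̃ ⊂ Ũ ⊂ ℝⁿ × ℝⁿ, where K̃ is closed, Ũ is open, both are invariant under the translations (x,p) ↦ (x+m, p) (m ∈ ℤⁿ), the projections of K̃ and Ũ to the second factor are bounded, and φ̃_t(K̃) ⊆ K̃ for all t ∈ ℝ. Then for every c₀ > 0 there exist ε₀ > 0 and c₁ > 0 such that: for every ε ∈ (0, ε₀), every C^k map u : ℝⁿ × ℝⁿ → ℝⁿ × ℝⁿ that is ℤⁿ-periodic in the first factor and satisfies sup over Ũ of the norms of the derivatives of u − εX of all orders ≤ k bounded by c₀ε², and every m ∈ ℕ with mε ≤ c₀, one has sup over K̃ of the norms of the derivatives of all orders ≤ k of (id + u)^m − φ̃_{mε} bounded by c₁ε. -/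
open MeasureTheory Filter
open scoped NNReal

noncomputable section

abbrev E (n : ℕ) : Type := Fin n → ℝ

/-- The vector of `ℝⁿ` whose coordinates are the integers `m i`. -/
def intVec {n : ℕ} (m : Fin n → ℤ) : E n := fun i => (m i : ℝ)

/-- A Tonelli Hamiltonian on `T*𝕋ⁿ`, identified with a `ℤⁿ`-periodic (in `x`) function
on `ℝⁿ × ℝⁿ` which is `Cᵏ`, uniformly superlinear in `p` and with positive definite
fiberwise Hessian. -/
structure IsTonelliHamiltonian (n : ℕ) (k : ℕ∞) (H : E n × E n → ℝ) : Prop where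
  smooth : ContDiff ℝ k H
  periodic : ∀ (x p : E n) (m : Fin n → ℤ), H (x + intVec m, p) = H (x, p)
  superlinear : ∀ C : ℝ, ∃ R : ℝ, ∀ (x p : E n), R ≤ ‖p‖ → C * ‖p‖ ≤ H (x, p)
  posdef : ∀ (x p w : E n), w ≠ 0 →
    0 < fderiv ℝ (fun p' => fderiv ℝ (fun p'' => H (x, p'')) p' w) p w

/-- The gradient of `H` in the fiber direction, `∂H/∂p (x, p)`, as a vector of `ℝⁿ`. -/
def gradP (n : ℕ) (H : E n × E n → ℝ) (x p : E n) : E n :=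
  fun i => fderiv ℝ (fun p' => H (x, p')) p (Pi.single i 1)

/-- The gradient of `H` in the base direction, `∂H/∂x (x, p)`, as a vector of `ℝⁿ`. -/
def gradX (n : ℕ) (H : E n × E n → ℝ) (x p : E n) : E n :=
  fun i => fderiv ℝ (fun x' => H (x', p)) x (Pi.single i 1)

/-- The Hamiltonian vector field `X_H (x, p) = (∂H/∂p, -∂H/∂x)`. -/
def hamVF (n : ℕ) (H : E n × E n → ℝ) (z : E n × E n) : E n × E n :=
  (gradP n H z.1 z.2, -gradX n H z.1 z.2)

/-- `φ` is the complete Hamiltonian flow of `H` on `ℝⁿ × ℝⁿ`. -/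
def IsHamFlow (n : ℕ) (H : E n × E n → ℝ) (φ : ℝ → E n × E n → E n × E n) : Prop :=
  (∀ z : E n × E n, φ 0 z = z) ∧
  ∀ (z : E n × E n) (t : ℝ), HasDerivAt (fun s => φ s z) (hamVF n H (φ t z)) t

/-- The flow `φ` has no conjugate points: for `t ≠ 0` the image of the vertical
subspace `{0} × ℝⁿ` under `Dφ_t(z)` meets `{0} × ℝⁿ` only in `0`. -/
def NoConjugatePoints (n : ℕ) (φ : ℝ → E n × E n → E n × E n) : Prop :=
  ∀ (z : E n × E n) (t : ℝ), t ≠ 0 → ∀ w : E n,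
    (fderiv ℝ (φ t) z (0, w)).1 = 0 → w = 0

/-- The gradient of a function `u : ℝⁿ → ℝ`, as a vector of `ℝⁿ`. -/
def gradF (n : ℕ) (u : E n → ℝ) (x : E n) : E n :=
  fun i => fderiv ℝ u x (Pi.single i 1)

/-- The euclidean pairing of two vectors of `ℝⁿ`. -/
def dotP (n : ℕ) (a b : E n) : ℝ := ∑ i, a i * b i

/-- The standard symplectic form `ω₀((a,b),(a',b')) = ⟨b, a'⟩ − ⟨a, b'⟩` on `ℝⁿ × ℝⁿ`. -/
def omega0 (n : ℕ) (w w' : E n × E n) : ℝ := dotP n w.2 w'.1 - dotP n w.1 w'.2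

/-- The Jacobian matrix of a map `ψ : ℝⁿ → ℝⁿ` at `x`. -/
def jacobian (n : ℕ) (ψ : E n → E n) (x : E n) : Matrix (Fin n) (Fin n) ℝ :=
  Matrix.of fun i j => fderiv ℝ (fun y => ψ y i) x (Pi.single j 1)

/-- `R = O(Iˢ)` near the zero section: on some neighborhood `{‖I‖ ≤ ε}` of `𝕋ⁿ × {0}`,
all mixed partial derivatives `∂_θ^a ∂_I^b R` with `b < s` are bounded by
`C_{a,b} ‖I‖^{s-b}`. -/
def BigOI (n : ℕ) (s : ℕ) (R : E n × E n → E n) : Prop :=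
  ∃ ε : ℝ, 0 < ε ∧ ∀ a b : ℕ, b < s → ∃ C : ℝ, ∀ θ I : E n, ‖I‖ ≤ ε →
    ‖iteratedFDeriv ℝ a (fun θ' => iteratedFDeriv ℝ b (fun I' => R (θ', I')) I) θ‖
      ≤ C * ‖I‖ ^ (s - b)

/-- A strongly Diophantine vector of `ℝⁿ`. -/
def StronglyDiophantine (n : ℕ) (ω : E n) : Prop :=
  ∃ γ : ℝ, 0 < γ ∧ ∃ τ : ℝ, ∀ k : Fin n → ℤ, k ≠ 0 → ∀ l : ℤ,
    γ / ‖intVec k‖ ^ τ ≤ |dotP n (intVec k) ω + (l : ℝ)|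

/-- The `Cᵏ` norm of a map `ℝⁿ → ℝⁿ` (the supremum of the norms of all its iterated
derivatives of order `≤ k`; a genuine supremum for periodic smooth maps). -/
noncomputable def CkNorm (n k : ℕ) (f : E n → E n) : ℝ :=
  ⨆ p : E n × Fin (k + 1), ‖iteratedFDeriv ℝ (p.2 : ℕ) f p.1‖

section FlowRegularity

open Set Metric Topology

variable {V : Type*} [NormedAddCommGroup V] [NormedSpace ℝ V]

/-- `γ` solves the autonomous equation `γ' = X ∘ γ` on the time interval `[0, T]`. -/
def SolvesOn (X : V → V) (T : ℝ) (γ : ℝ → V) : Prop :=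
  ∀ t ∈ Icc 0 T, HasDerivWithinAt γ (X (γ t)) (Icc 0 T) t

/-- `φ` is a semiflow of `X`, defined on the whole space for times in `[0, T]`. -/
def IsSemiflow (X : V → V) (T : ℝ) (φ : ℝ → V → V) : Prop :=
  ∀ z, φ 0 z = z ∧ SolvesOn X T fun t => φ t z

/-- The tangent lift `(z, v) ↦ (f z, Df(z) v)` of a map `f`. -/
def tangentLift (f : V → V) (p : V × V) : V × V := (f p.1, fderiv ℝ f p.1 p.2)

lemma HasDerivWithinAt.Ici_of_Icc {W : Type*} [NormedAddCommGroup W] [NormedSpace ℝ W]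
    {f : ℝ → W} {f' : W} {T t : ℝ} (ht : t ∈ Ico 0 T)
    (h : HasDerivWithinAt f f' (Icc 0 T) t) : HasDerivWithinAt f f' (Ici t) t :=
  h.mono_of_mem_nhdsWithin (mem_of_superset (Icc_mem_nhdsGE ht.2)
    (Icc_subset_Icc_left ht.1))

lemma SolvesOn.continuousOn {X : V → V} {T : ℝ} {γ : ℝ → V} (h : SolvesOn X T γ) :
    ContinuousOn γ (Icc 0 T) := fun t ht => (h t ht).continuousWithinAt

lemma exists_lipschitzOnWith_closedBall [FiniteDimensional ℝ V] {X : V → V}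
    (hX : ContDiff ℝ 1 X) (R : ℝ) :
    ∃ L : ℝ≥0, LipschitzOnWith L X (closedBall 0 R) ∧
      ∀ x ∈ closedBall (0 : V) R, ‖fderiv ℝ X x‖ ≤ L := by
  have : ProperSpace V := FiniteDimensional.proper ℝ V
  obtain ⟨C, hC⟩ := (isCompact_closedBall (0 : V) R).exists_bound_of_continuousOn
    (hX.continuous_fderiv one_ne_zero).continuousOn
  have hb : ∀ x ∈ closedBall (0 : V) R, ‖fderiv ℝ X x‖ ≤ C.toNNReal := fun x hx =>
    (hC x hx).trans (Real.le_coe_toNNReal C)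
  exact ⟨C.toNNReal, (convex_closedBall _ _).lipschitzOnWith_of_nnnorm_fderiv_le
    (fun x _ => hX.differentiable one_ne_zero x) (fun x hx => by exact_mod_cast hb x hx), hb⟩

lemma SolvesOn.exists_norm_sub_le [FiniteDimensional ℝ V] {X : V → V} (hX : ContDiff ℝ 1 X)
    {T : ℝ} {γ : ℝ → V} (hγ : SolvesOn X T γ) :
    ∃ δ > 0, ∃ C > 0, ∀ η, SolvesOn X T η → ‖η 0 - γ 0‖ < δ →
      ∀ t ∈ Icc 0 T, ‖η t - γ t‖ ≤ C * ‖η 0 - γ 0‖ := by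
  obtain ⟨B, hB⟩ := isCompact_Icc.exists_bound_of_continuousOn hγ.continuousOn
  obtain ⟨L, hL, -⟩ := exists_lipschitzOnWith_closedBall hX (B + 1)
  refine ⟨Real.exp (-(L * T)), Real.exp_pos _, Real.exp (L * T), Real.exp_pos _,
    fun η hη h0 => ?_⟩
  have key : ∀ b ∈ Icc 0 T, (∀ t ∈ Ico 0 b, ‖η t - γ t‖ < 1) →
      ‖η b - γ b‖ ≤ Real.exp (L * T) * ‖η 0 - γ 0‖ := by
    intro b hb hlt
    have hsub : Icc 0 b ⊆ Icc 0 T := Icc_subset_Icc_right hb.2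
    have hmem : ∀ t ∈ Ico 0 b, t ∈ Icc 0 T := fun t ht => ⟨ht.1, ht.2.le.trans hb.2⟩
    have hmem' : ∀ t ∈ Ico 0 b, t ∈ Ico 0 T := fun t ht => ⟨ht.1, ht.2.trans_le hb.2⟩
    have := dist_le_of_trajectories_ODE_of_mem (v := fun _ => X) (K := L)
      (s := fun _ => closedBall 0 (B + 1)) (δ := ‖η 0 - γ 0‖) (a := 0) (b := b)
      (fun _ _ => hL) (hη.continuousOn.mono hsub)
      (fun t ht => (hη t (hmem t ht)).Ici_of_Icc (hmem' t ht))
      (fun t ht => by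
        have h1 := hB t (hmem t ht)
        have h2 := hlt t ht
        have h3 := norm_le_norm_add_norm_sub' (η t) (γ t)
        rw [mem_closedBall_zero_iff]; linarith)
      (hγ.continuousOn.mono hsub)
      (fun t ht => (hγ t (hmem t ht)).Ici_of_Icc (hmem' t ht))
      (fun t ht => by
        have h1 := hB t (hmem t ht)
        rw [mem_closedBall_zero_iff]; linarith)
      (dist_eq_norm _ _).le b (right_mem_Icc.2 hb.1)
    rw [dist_eq_norm, sub_zero, mul_comm] at this
    refine this.trans ?_
    gcongr
    exact hb.2
  have hsmall : Real.exp (L * T) * ‖η 0 - γ 0‖ < 1 := by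
    have := mul_lt_mul_of_pos_left h0 (Real.exp_pos (L * T))
    rwa [← Real.exp_add, add_neg_cancel, Real.exp_zero] at this
  have hall : ∀ t ∈ Icc 0 T, ‖η t - γ t‖ < 1 := by
    by_contra! hcon
    have hcont : ContinuousOn (fun t => ‖η t - γ t‖) (Icc 0 T) :=
      (hη.continuousOn.sub hγ.continuousOn).norm
    have hcl : IsCompact (Icc 0 T ∩ (fun t => ‖η t - γ t‖) ⁻¹' Ici 1) :=
      isCompact_Icc.of_isClosed_subset
        (hcont.preimage_isClosed_of_isClosed isClosed_Icc isClosed_Ici) inter_subset_left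
    obtain ⟨b, ⟨hb, hb1⟩, hmin⟩ := hcl.exists_isLeast (by
      obtain ⟨t, ht, h1⟩ := hcon
      exact ⟨t, ht, h1⟩)
    have h1 := key b hb fun t ht => by
      by_contra! h
      exact absurd (hmin ⟨⟨ht.1, ht.2.le.trans hb.2⟩, h⟩) (not_le.2 ht.2)
    exact absurd (h1.trans_lt hsmall) (not_lt.2 hb1)
  exact fun t ht => key t ht fun s hs => hall s ⟨hs.1, hs.2.le.trans ht.2⟩

lemma SolvesOn.eqOn [FiniteDimensional ℝ V] {X : V → V} (hX : ContDiff ℝ 1 X)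
    {T : ℝ} {γ η : ℝ → V} (hγ : SolvesOn X T γ) (hη : SolvesOn X T η) (h0 : η 0 = γ 0) :
    ∀ t ∈ Icc 0 T, η t = γ t := by
  obtain ⟨δ, hδ, C, -, h⟩ := hγ.exists_norm_sub_le hX
  intro t ht
  simpa [h0, sub_eq_zero] using h η hη (by simpa [h0] using hδ) t ht

lemma IsSemiflow.continuousOn_uncurry [FiniteDimensional ℝ V] {X : V → V}
    (hX : ContDiff ℝ 1 X) {T : ℝ} {φ : ℝ → V → V} (hφ : IsSemiflow X T φ) :
    ContinuousOn (fun p : ℝ × V => φ p.1 p.2) (Icc 0 T ×ˢ univ) := by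
  rintro ⟨t, z⟩ ⟨ht, -⟩
  obtain ⟨δ, hδ, C, hC, h⟩ := (hφ z).2.exists_norm_sub_le hX
  have h1 : Tendsto (fun p : ℝ × V => φ p.1 z) (𝓝[Icc 0 T ×ˢ univ] (t, z)) (𝓝 (φ t z)) :=
    ((hφ z).2.continuousOn t ht).tendsto.comp
      (tendsto_nhdsWithin_iff.2 ⟨(continuous_fst.tendsto _).mono_left nhdsWithin_le_nhds,
        eventually_mem_nhdsWithin.mono fun p hp => hp.1⟩)
  have h2 : Tendsto (fun p : ℝ × V => φ p.1 p.2 - φ p.1 z)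
      (𝓝[Icc 0 T ×ˢ univ] (t, z)) (𝓝 0) := by
    have hlim : Tendsto (fun p : ℝ × V => C * ‖p.2 - z‖) (𝓝[Icc 0 T ×ˢ univ] (t, z)) (𝓝 0) := by
      have : Continuous fun p : ℝ × V => C * ‖p.2 - z‖ := by fun_prop
      simpa using (this.tendsto (t, z)).mono_left nhdsWithin_le_nhds
    refine squeeze_zero_norm' ?_ hlim
    have hnear : ∀ᶠ p : ℝ × V in 𝓝[Icc 0 T ×ˢ univ] (t, z), ‖p.2 - z‖ < δ := by
      have : Continuous fun p : ℝ × V => ‖p.2 - z‖ := by fun_prop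
      exact ((this.tendsto (t, z)).mono_left nhdsWithin_le_nhds).eventually
        (gt_mem_nhds (by simpa using hδ))
    filter_upwards [hnear, eventually_mem_nhdsWithin] with p hp hpm
    have := h _ (hφ p.2).2 (by simpa only [(hφ _).1] using hp) p.1 hpm.1
    simpa only [(hφ _).1] using this
  simpa [ContinuousWithinAt] using h2.add h1

lemma IsSemiflow.isCompact_image [FiniteDimensional ℝ V] {X : V → V}
    (hX : ContDiff ℝ 1 X) {T : ℝ} {φ : ℝ → V → V} (hφ : IsSemiflow X T φ)
    {K : Set V} (hK : IsCompact K) :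
    IsCompact ((fun p : ℝ × V => φ p.1 p.2) '' (Icc 0 T ×ˢ K)) :=
  (isCompact_Icc.prod hK).image_of_continuousOn
    ((hφ.continuousOn_uncurry hX).mono (prod_mono_right (subset_univ _)))

lemma exists_hasDerivWithinAt_linear {W : Type*} [NormedAddCommGroup W] [NormedSpace ℝ W]
    [FiniteDimensional ℝ W] {T : ℝ} (hT : 0 ≤ T) {A : ℝ → W →L[ℝ] W}
    (hA : ContinuousOn A (Icc 0 T)) (y₀ : W) :
    ∃ y : ℝ → W, y 0 = y₀ ∧ ∀ t ∈ Icc 0 T, HasDerivWithinAt y (A t (y t)) (Icc 0 T) t := by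
  obtain ⟨M, hM⟩ := isCompact_Icc.exists_bound_of_continuousOn hA
  have hM0 : 0 ≤ M := (norm_nonneg _).trans (hM 0 (left_mem_Icc.2 hT))
  set R : ℝ := ‖y₀‖ * Real.exp (M * T) + 1
  have hR : 0 < R := by positivity
  -- cutting off the linear field makes it bounded and globally Lipschitz
  let χ : ContDiffBump (0 : W) := ⟨R, R + 1, hR, by linarith⟩
  set F : W → W := fun y => χ y • y with hF
  have hFle : ∀ y, ‖F y‖ ≤ ‖y‖ := fun y => by
    rw [hF, norm_smul, Real.norm_of_nonneg χ.nonneg]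
    exact mul_le_of_le_one_left (norm_nonneg _) χ.le_one
  have hFbd : ∀ y, ‖F y‖ ≤ R + 1 := fun y => by
    by_cases hy : ‖y‖ ≤ R + 1
    · exact (hFle y).trans hy
    · have : χ y = 0 := χ.zero_of_le_dist (by simpa using (not_le.1 hy).le)
      simp only [hF, this, zero_smul, norm_zero]
      linarith
  have hFeq : ∀ y, ‖y‖ ≤ R → F y = y := fun y hy => by
    have : χ y = 1 := χ.one_of_mem_closedBall (by simpa using hy)
    simp [hF, this]
  obtain ⟨L, hL⟩ := ContDiff.lipschitzWith_of_hasCompactSupport (f := F) (n := 1) (𝕂 := ℝ)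
    (χ.hasCompactSupport.smul_right) (χ.contDiff.smul contDiff_id) one_ne_zero
  have hPL : IsPicardLindelof (fun t y => A t (F y)) (tmin := 0) (tmax := T)
      ⟨0, left_mem_Icc.2 hT⟩ y₀ (M * (R + 1) * T).toNNReal 0 (M * (R + 1)).toNNReal
      (M.toNNReal * L) := by
    refine ⟨fun t ht => ?_, fun x _ => hA.clm_apply continuousOn_const, fun t ht x _ => ?_, ?_⟩
    · refine LipschitzOnWith.mono (((A t).lipschitz.weaken ?_).comp hL).lipschitzOnWith
        (subset_univ _)
      rw [← NNReal.coe_le_coe, Real.coe_toNNReal _ hM0]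
      exact hM t ht
    · rw [Real.coe_toNNReal _ (by positivity)]
      exact ((A t).le_opNorm _).trans (mul_le_mul (hM t ht) (hFbd x) (norm_nonneg _) hM0)
    · rw [Real.coe_toNNReal _ (by positivity), Real.coe_toNNReal _ (by positivity)]
      simp [hT]
  obtain ⟨y, hy0, hy⟩ := hPL.exists_eq_forall_mem_Icc_hasDerivWithinAt₀
  refine ⟨y, hy0, fun t ht => ?_⟩
  have hgr := norm_le_gronwallBound_of_norm_deriv_right_le (δ := ‖y₀‖) (K := M) (ε := 0)
    (fun t ht => (hy t ht).continuousWithinAt)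
    (fun t ht => (hy t (Ico_subset_Icc_self ht)).Ici_of_Icc ht)
    (by rw [← hy0]) (fun t ht => by
      rw [add_zero]
      exact ((A t).le_opNorm _).trans (mul_le_mul (hM t (Ico_subset_Icc_self ht)) (hFle _)
        (norm_nonneg _) hM0)) t ht
  rw [gronwallBound_ε0, sub_zero] at hgr
  have hyR : ‖y t‖ ≤ R := by
    refine hgr.trans (le_trans ?_ (le_add_of_nonneg_right zero_le_one))
    gcongr
    exact ht.2
  simpa only [hFeq _ hyR] using hy t ht

lemma gronwallBound_zero_le {K ε x : ℝ} (hK : 1 ≤ K) (hε : 0 ≤ ε) :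
    gronwallBound 0 K ε x ≤ ε * Real.exp (K * x) := by
  simp only [gronwallBound_of_K_ne_0 (show K ≠ 0 by positivity), zero_mul, zero_add]
  calc ε / K * (Real.exp (K * x) - 1)
      ≤ ε / K * Real.exp (K * x) := by gcongr; linarith
    _ ≤ ε * Real.exp (K * x) := by gcongr; exact div_le_self hε hK

/-- First order Taylor estimate, uniform on bounded sets. -/
lemma exists_taylor_bound [FiniteDimensional ℝ V] {X : V → V} (hX : ContDiff ℝ 1 X)
    (R : ℝ) {ε : ℝ} (hε : 0 < ε) : ∃ δ > 0, ∀ p q : V, ‖p‖ ≤ R → ‖q - p‖ < δ →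
      ‖X q - X p - fderiv ℝ X p (q - p)‖ ≤ ε * ‖q - p‖ := by
  have : ProperSpace V := FiniteDimensional.proper ℝ V
  have huc := (isCompact_closedBall (0 : V) (R + 1)).uniformContinuousOn_of_continuous
    (hX.continuous_fderiv one_ne_zero).continuousOn
  obtain ⟨δ, hδ, h⟩ := Metric.uniformContinuousOn_iff.1 huc ε hε
  refine ⟨min δ 1, lt_min hδ one_pos, fun p q hp hq => ?_⟩
  have hpq : 0 < min δ 1 := lt_min hδ one_pos
  refine (convex_ball p (min δ 1)).norm_image_sub_le_of_norm_hasFDerivWithin_le'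
    (f' := fderiv ℝ X)
    (fun x _ => (hX.differentiable one_ne_zero x).hasFDerivAt.hasFDerivWithinAt)
    (fun x hx => ?_) (mem_ball_self hpq) (by rwa [mem_ball, dist_eq_norm])
  have hx' : dist x p < min δ 1 := hx
  rw [← dist_eq_norm]
  refine (h x ?_ p ?_ (hx'.trans_le (min_le_left _ _))).le
  · have h1 := norm_le_norm_add_norm_sub' x p
    have h2 := hx'.trans_le (min_le_right _ _)
    rw [dist_eq_norm] at h2
    rw [mem_closedBall_zero_iff]
    linarith
  · rw [mem_closedBall_zero_iff]
    linarith

lemma IsSemiflow.exists_fderiv [FiniteDimensional ℝ V] {X : V → V}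
    (hX : ContDiff ℝ 1 X) {T : ℝ} (hT : 0 ≤ T) {φ : ℝ → V → V} (hφ : IsSemiflow X T φ) (z : V) :
    ∃ Y : ℝ → V →L[ℝ] V, Y 0 = ContinuousLinearMap.id ℝ V ∧
      (∀ t ∈ Icc 0 T, HasFDerivAt (φ t) (Y t) z) ∧
      ∀ t ∈ Icc 0 T, HasDerivWithinAt Y ((fderiv ℝ X (φ t z)).comp (Y t)) (Icc 0 T) t := by
  have hA : ContinuousOn (fun t => fderiv ℝ X (φ t z)) (Icc 0 T) :=
    (hX.continuous_fderiv one_ne_zero).comp_continuousOn (hφ z).2.continuousOn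
  obtain ⟨Y, hY0, hY⟩ := exists_hasDerivWithinAt_linear hT
    (A := fun t => ContinuousLinearMap.compL ℝ V V V (fderiv ℝ X (φ t z)))
    ((ContinuousLinearMap.compL ℝ V V V).continuous.comp_continuousOn hA)
    (ContinuousLinearMap.id ℝ V)
  refine ⟨Y, hY0, fun t ht => ?_, hY⟩
  obtain ⟨B, hB⟩ := isCompact_Icc.exists_bound_of_continuousOn (hφ z).2.continuousOn
  obtain ⟨M, hM⟩ := isCompact_Icc.exists_bound_of_continuousOn hA
  obtain ⟨δ, hδ, C, hC, hlip⟩ := (hφ z).2.exists_norm_sub_le hX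
  rw [hasFDerivAt_iff_isLittleO, Asymptotics.isLittleO_iff]
  intro c hc
  set K := max M 1
  set ε := c / (C * Real.exp (K * T))
  have hε : 0 < ε := by positivity
  obtain ⟨δ', hδ', htay⟩ := exists_taylor_bound hX B hε
  have hnear : ∀ᶠ w in 𝓝 z, ‖w - z‖ < min δ (δ' / C) := by
    have : Continuous fun w : V => ‖w - z‖ := by fun_prop
    exact (this.tendsto z).eventually (gt_mem_nhds (by
      rw [sub_self, norm_zero]
      exact lt_min hδ (by positivity)))
  filter_upwards [hnear] with w hw
  have hd : ∀ s ∈ Icc 0 T, ‖φ s w - φ s z‖ ≤ C * ‖w - z‖ := fun s hs => by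
    simpa only [(hφ _).1] using hlip _ (hφ w).2
      (by simpa only [(hφ _).1] using hw.trans_le (min_le_left _ _)) s hs
  have hd' : C * ‖w - z‖ < δ' := by
    have := hw.trans_le (min_le_right _ _)
    rwa [lt_div_iff₀' hC] at this
  have hderiv : ∀ s ∈ Icc 0 T, HasDerivWithinAt (fun s => φ s w - φ s z - Y s (w - z))
      (X (φ s w) - X (φ s z) - fderiv ℝ X (φ s z) (Y s (w - z))) (Icc 0 T) s := fun s hs =>
    (((hφ w).2 s hs).sub ((hφ z).2 s hs)).sub
      (by simpa using (hY s hs).clm_apply (hasDerivWithinAt_const s (Icc 0 T) (w - z)))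
  have hgr := norm_le_gronwallBound_of_norm_deriv_right_le (δ := 0) (K := K)
    (ε := ε * (C * ‖w - z‖))
    (fun s hs => (hderiv s hs).continuousWithinAt)
    (fun s hs => (hderiv s (Ico_subset_Icc_self hs)).Ici_of_Icc hs)
    (by simp [(hφ _).1, hY0])
    (fun s hs => by
      have hs' := Ico_subset_Icc_self hs
      have h1 := htay _ (φ s w) (hB s hs') ((hd s hs').trans_lt hd')
      have h2 : X (φ s w) - X (φ s z) - fderiv ℝ X (φ s z) (Y s (w - z)) =
          fderiv ℝ X (φ s z) (φ s w - φ s z - Y s (w - z)) +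
          (X (φ s w) - X (φ s z) - fderiv ℝ X (φ s z) (φ s w - φ s z)) := by
        rw [map_sub (fderiv ℝ X (φ s z)) (φ s w - φ s z) (Y s (w - z))]
        abel
      rw [h2]
      refine (norm_add_le _ _).trans (add_le_add ?_ (h1.trans ?_))
      · refine ((fderiv ℝ X (φ s z)).le_opNorm _).trans ?_
        gcongr
        exact (hM s hs').trans (le_max_left _ _)
      · gcongr
        exact hd s hs') t ht
  refine hgr.trans ((gronwallBound_zero_le (le_max_right _ _) (by positivity)).trans ?_)
  rw [sub_zero]
  calc ε * (C * ‖w - z‖) * Real.exp (K * t)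
      ≤ ε * (C * ‖w - z‖) * Real.exp (K * T) := by
        gcongr
        exact ht.2
    _ = ε * (C * Real.exp (K * T)) * ‖w - z‖ := by ring
    _ = c * ‖w - z‖ := by rw [div_mul_cancel₀ _ (by positivity)]

lemma IsSemiflow.differentiable [FiniteDimensional ℝ V] {X : V → V}
    (hX : ContDiff ℝ 1 X) {T : ℝ} {φ : ℝ → V → V} (hφ : IsSemiflow X T φ)
    {t : ℝ} (ht : t ∈ Icc 0 T) : Differentiable ℝ (φ t) := fun z => by
  obtain ⟨Y, -, hY, -⟩ := hφ.exists_fderiv hX (ht.1.trans ht.2) z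
  exact (hY t ht).differentiableAt

lemma IsSemiflow.isSemiflow_tangentLift [FiniteDimensional ℝ V] {X : V → V}
    (hX : ContDiff ℝ 1 X) {T : ℝ} (hT : 0 ≤ T) {φ : ℝ → V → V} (hφ : IsSemiflow X T φ) :
    IsSemiflow (tangentLift X) T fun t => tangentLift (φ t) := by
  rintro ⟨z, v⟩
  obtain ⟨Y, hY0, hY, hY'⟩ := hφ.exists_fderiv hX hT z
  have heq : ∀ t ∈ Icc 0 T, fderiv ℝ (φ t) z = Y t := fun t ht => (hY t ht).fderiv
  refine ⟨?_, fun t ht => ?_⟩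
  · simp [tangentLift, heq 0 (left_mem_Icc.2 hT), hY0, (hφ z).1]
  · have h2 : HasDerivWithinAt (fun s => fderiv ℝ (φ s) z v)
        (fderiv ℝ X (φ t z) (fderiv ℝ (φ t) z v)) (Icc 0 T) t := by
      have := (hY' t ht).clm_apply (hasDerivWithinAt_const t (Icc 0 T) v)
      simp only [map_zero, add_zero, ContinuousLinearMap.comp_apply] at this
      rw [heq t ht]
      exact this.congr_of_mem (fun s hs => by rw [heq s hs]) ht
    exact ((hφ z).2 t ht).prodMk h2

lemma ContDiff.contDiff_tangentLift {X : V → V} {k : ℕ} (hX : ContDiff ℝ (k + 1 : ℕ) X) :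
    ContDiff ℝ k (tangentLift X) := by
  have h1 : ContDiff ℝ k (fderiv ℝ X) := hX.fderiv_right (by norm_cast)
  have h0 : ContDiff ℝ k X := hX.of_le (by norm_cast; omega)
  exact (h0.comp contDiff_fst).prodMk ((h1.comp contDiff_fst).clm_apply contDiff_snd)

lemma ContDiff.of_tangentLift [FiniteDimensional ℝ V] {f : V → V} {k : ℕ}
    (hf : Differentiable ℝ f) (h : ContDiff ℝ k (tangentLift f)) :
    ContDiff ℝ (k + 1 : ℕ) f := by
  rw [Nat.cast_add, Nat.cast_one, contDiff_succ_iff_fderiv]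
  refine ⟨hf, fun h => absurd h (by simp), contDiff_clm_apply_iff.2 fun v => ?_⟩
  exact contDiff_snd.comp (h.comp (contDiff_id.prodMk contDiff_const))

/-- The time-`t` map of the semiflow of a `C^{k+1}` vector field is `C^k`. -/
theorem IsSemiflow.contDiff.{u} (k : ℕ) : ∀ {V : Type u} [NormedAddCommGroup V] [NormedSpace ℝ V]
    [FiniteDimensional ℝ V] {X : V → V}, ContDiff ℝ (k + 1 : ℕ) X → ∀ {T : ℝ} {φ : ℝ → V → V},
    IsSemiflow X T φ → ∀ t ∈ Icc 0 T, ContDiff ℝ k (φ t) := by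
  induction k with
  | zero =>
    intro V _ _ _ X hX T φ hφ t ht
    exact contDiff_zero.2 (hφ.differentiable (by simpa using hX) ht).continuous
  | succ k ih =>
    intro V _ _ _ X hX T φ hφ t ht
    have hX1 : ContDiff ℝ 1 X := hX.of_le (by norm_cast; omega)
    exact ContDiff.of_tangentLift (hφ.differentiable hX1 ht) (ih hX.contDiff_tangentLift
      (hφ.isSemiflow_tangentLift hX1 (ht.1.trans ht.2)) t ht)

lemma contDiff_iterate {f : V → V} {k : WithTop ℕ∞} (hf : ContDiff ℝ k f) (m : ℕ) :
    ContDiff ℝ k f^[m] := by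
  induction m with
  | zero => exact contDiff_id
  | succ m ih => exact ih.comp hf

lemma contDiff_id_add {u : V → V} {k : WithTop ℕ∞} (hu : ContDiff ℝ k u) :
    ContDiff ℝ k fun y => y + u y := contDiff_id.add hu

lemma tangentLift_iterate_id_add {u : V → V} (hu : ContDiff ℝ 1 u) (m : ℕ) :
    tangentLift (fun y => y + u y)^[m] = (fun p => p + tangentLift u p)^[m] := by
  induction m with
  | zero => ext p <;> simp [tangentLift]
  | succ m ih =>
    funext p
    have hf : DifferentiableAt ℝ (fun y => y + u y) p.1 :=
      (contDiff_id_add hu).differentiable one_ne_zero _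
    have hfm : DifferentiableAt ℝ (fun y => y + u y)^[m] (p.1 + u p.1) :=
      (contDiff_iterate (contDiff_id_add hu) m).differentiable one_ne_zero _
    have h1 : p + tangentLift u p = tangentLift (fun y => y + u y) p := by
      have hd : HasFDerivAt (fun y => y + u y) (ContinuousLinearMap.id ℝ V + fderiv ℝ u p.1) p.1 :=
        (hasFDerivAt_id _).add (hu.differentiable one_ne_zero _).hasFDerivAt
      simp only [tangentLift, hd.fderiv]
      rfl
    rw [Function.iterate_succ_apply, ← ih, h1]
    simp only [tangentLift, Function.iterate_succ]
    rw [fderiv_comp (f := fun y => y + u y) p.1 hfm hf]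
    rfl

lemma tangentLift_sub {f g : V → V} (hf : Differentiable ℝ f) (hg : Differentiable ℝ g) :
    tangentLift (fun w => f w - g w) = fun p => tangentLift f p - tangentLift g p := by
  funext p
  simp only [tangentLift, fderiv_fun_sub (hf _) (hg _)]
  rfl

lemma tangentLift_const_smul {f : V → V} (hf : Differentiable ℝ f) (c : ℝ) :
    tangentLift (fun w => c • f w) = fun p => c • tangentLift f p := by
  funext p
  simp only [tangentLift, fderiv_fun_const_smul (hf _)]
  rfl

lemma norm_iteratedFDeriv_comp_clm_le {V W G : Type*} [NormedAddCommGroup V] [NormedSpace ℝ V]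
    [NormedAddCommGroup W] [NormedSpace ℝ W] [NormedAddCommGroup G] [NormedSpace ℝ G]
    (L : W →L[ℝ] V) (hL : ‖L‖ ≤ 1) {f : V → G}
    {i : ℕ} (hf : ContDiff ℝ i f) (x : W) :
    ‖iteratedFDeriv ℝ i (fun w => f (L w)) x‖ ≤ ‖iteratedFDeriv ℝ i f (L x)‖ := by
  have := L.iteratedFDeriv_comp_right hf x le_rfl
  change ‖iteratedFDeriv ℝ i (f ∘ L) x‖ ≤ _
  rw [this]
  refine (ContinuousMultilinearMap.norm_compContinuousLinearMap_le _ _).trans ?_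
  exact mul_le_of_le_one_right (norm_nonneg _)
    (Finset.prod_le_one (fun _ _ => norm_nonneg _) fun _ _ => hL)

lemma norm_iteratedFDeriv_succ_le_of_tangentLift {f : V → V} {i : ℕ}
    (hf : ContDiff ℝ (i + 1 : ℕ) f) {z : V} {C : ℝ} (hC : 0 ≤ C)
    (h : ∀ v ∈ closedBall (0 : V) 1, ‖iteratedFDeriv ℝ i (tangentLift f) (z, v)‖ ≤ C) :
    ‖iteratedFDeriv ℝ (i + 1) f z‖ ≤ C := by
  have hdf : ContDiff ℝ i (fderiv ℝ f) := hf.fderiv_right (by norm_cast)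
  have hT : ContDiff ℝ i (tangentLift f) := hf.contDiff_tangentLift
  have key : ∀ v ∈ closedBall (0 : V) 1,
      ‖iteratedFDeriv ℝ i (fun w => fderiv ℝ f w v) z‖ ≤ C := by
    intro v hv
    let S : V × V → V := fun p => (tangentLift f (p + (0, v))).2
    have hshift : ContDiff ℝ i fun p => tangentLift f (p + (0, v)) :=
      hT.comp (contDiff_id.add contDiff_const)
    have hS : ContDiff ℝ i S := contDiff_snd.comp hshift
    have h1 := norm_iteratedFDeriv_comp_clm_le (ContinuousLinearMap.inl ℝ V V)
      (ContinuousLinearMap.norm_inl_le_one ℝ V V) hS z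
    have h2 : (fun w => S (ContinuousLinearMap.inl ℝ V V w)) = fun w => fderiv ℝ f w v := by
      funext w
      simp [S, tangentLift]
    have h3 := (ContinuousLinearMap.snd ℝ V V).norm_iteratedFDeriv_comp_left
      (hshift.contDiffAt (x := ContinuousLinearMap.inl ℝ V V z)) le_rfl
    rw [h2] at h1
    refine h1.trans (h3.trans ?_)
    rw [iteratedFDeriv_comp_add_right]
    refine (mul_le_of_le_one_left (norm_nonneg _)
      (ContinuousLinearMap.norm_snd_le ℝ V V)).trans ?_
    simpa using h v hv
  rw [← norm_iteratedFDeriv_fderiv]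
  refine ContinuousMultilinearMap.opNorm_le_bound hC fun m => ?_
  refine ContinuousLinearMap.opNorm_le_of_unit_norm (by positivity) fun v hv => ?_
  rw [← iteratedFDeriv_clm_apply_const_apply hdf le_rfl]
  exact (ContinuousMultilinearMap.le_opNorm _ _).trans
    (mul_le_mul_of_nonneg_right (key v (by simp [hv])) (by positivity))

lemma norm_iteratedFDeriv_snd_le (j : ℕ) (p : V × V) :
    ‖iteratedFDeriv ℝ j (Prod.snd : V × V → V) p‖ ≤ ‖p.2‖ + 1 := by
  match j with
  | 0 => rw [norm_iteratedFDeriv_zero]; linarith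
  | 1 =>
    rw [norm_iteratedFDeriv_one, fderiv_snd]
    exact (ContinuousLinearMap.norm_snd_le ℝ V V).trans (by linarith [norm_nonneg p.2])
  | j + 2 =>
    rw [← norm_iteratedFDeriv_fderiv]
    have : fderiv ℝ (Prod.snd : V × V → V) = fun _ => ContinuousLinearMap.snd ℝ V V := by
      funext p; exact fderiv_snd
    rw [this, iteratedFDeriv_const_of_ne (Nat.succ_ne_zero j)]
    simp only [Pi.zero_apply, norm_zero]
    positivity

lemma norm_iteratedFDeriv_tangentLift_le {f : V → V} {k i : ℕ} (hi : i ≤ k)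
    (hf : ContDiff ℝ (k + 1 : ℕ) f) {z : V} {C : ℝ}
    (h : ∀ j ≤ k + 1, ‖iteratedFDeriv ℝ j f z‖ ≤ C) (v : V) :
    ‖iteratedFDeriv ℝ i (tangentLift f) (z, v)‖ ≤ C * (2 ^ k * (‖v‖ + 1)) := by
  have hC : 0 ≤ C := (norm_nonneg _).trans (h 0 (Nat.zero_le _))
  have hdf : ContDiff ℝ i (fderiv ℝ f) := hf.fderiv_right (by norm_cast; omega)
  have hf0 : ContDiff ℝ i f := hf.of_le (by norm_cast; omega)
  have hfst : ‖ContinuousLinearMap.fst ℝ V V‖ ≤ 1 := ContinuousLinearMap.norm_fst_le ℝ V V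
  have hdfst : ContDiff ℝ i fun p : V × V => fderiv ℝ f p.1 := hdf.comp contDiff_fst
  have h1 : ‖iteratedFDeriv ℝ i (fun p : V × V => f p.1) (z, v)‖ ≤ C :=
    (norm_iteratedFDeriv_comp_clm_le (ContinuousLinearMap.fst ℝ V V) hfst hf0 (z, v)).trans
      (h i (by omega))
  have h2 : ‖iteratedFDeriv ℝ i (fun p : V × V => fderiv ℝ f p.1 p.2) (z, v)‖ ≤
      C * (2 ^ i * (‖v‖ + 1)) := by
    refine (norm_iteratedFDeriv_clm_apply hdfst contDiff_snd (z, v) le_rfl).trans ?_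
    have hterm : ∀ j ∈ Finset.range (i + 1), (i.choose j : ℝ) *
        ‖iteratedFDeriv ℝ j (fun p : V × V => fderiv ℝ f p.1) (z, v)‖ *
        ‖iteratedFDeriv ℝ (i - j) (Prod.snd : V × V → V) (z, v)‖ ≤
        i.choose j * (C * (‖v‖ + 1)) := by
      intro j hj
      have hji : j ≤ i := by simpa [Nat.lt_succ_iff] using hj
      rw [mul_assoc]
      refine mul_le_mul_of_nonneg_left (mul_le_mul ?_ (norm_iteratedFDeriv_snd_le _ (z, v))
        (norm_nonneg _) hC) (Nat.cast_nonneg _)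
      refine (norm_iteratedFDeriv_comp_clm_le (ContinuousLinearMap.fst ℝ V V) hfst
        (hdf.of_le (by exact_mod_cast hji)) (z, v)).trans ?_
      rw [norm_iteratedFDeriv_fderiv]
      exact h (j + 1) (by omega)
    refine (Finset.sum_le_sum hterm).trans (le_of_eq ?_)
    rw [← Finset.sum_mul, ← Nat.cast_sum, Nat.sum_range_choose]
    push_cast
    ring
  have hpow : C * (2 ^ i * (‖v‖ + 1)) ≤ C * (2 ^ k * (‖v‖ + 1)) := by
    gcongr
    exact one_le_two
  have hone : C ≤ C * (2 ^ k * (‖v‖ + 1)) :=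
    le_mul_of_one_le_right hC (one_le_mul_of_one_le_of_one_le (one_le_pow₀ one_le_two)
      (by linarith [norm_nonneg v]))
  change ‖iteratedFDeriv ℝ i (fun p : V × V => (f p.1, fderiv ℝ f p.1 p.2)) (z, v)‖ ≤ _
  have hf0' : ContDiff ℝ i fun p : V × V => f p.1 := hf0.comp contDiff_fst
  rw [iteratedFDeriv_prodMk hf0'.contDiffAt
    (hdfst.clm_apply contDiff_snd).contDiffAt le_rfl, ContinuousMultilinearMap.opNorm_prod]
  exact max_le (h1.trans hone) (h2.trans hpow)

lemma SolvesOn.norm_euler_step_le {X : V → V} {T : ℝ} {γ : ℝ → V} (hγ : SolvesOn X T γ)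
    {s : Set V} (hs : ∀ t ∈ Icc 0 T, γ t ∈ s) {L : ℝ≥0} (hL : LipschitzOnWith L X s)
    {B : ℝ} (hB : ∀ t ∈ Icc 0 T, ‖X (γ t)‖ ≤ B) {t ε : ℝ} (ht : 0 ≤ t) (hε : 0 ≤ ε)
    (htε : t + ε ≤ T) : ‖γ (t + ε) - (γ t + ε • X (γ t))‖ ≤ L * B * ε ^ 2 := by
  have hsub : Icc t (t + ε) ⊆ Icc 0 T := Icc_subset_Icc ht htε
  have hleft : t ∈ Icc t (t + ε) := left_mem_Icc.2 (by linarith)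
  have hright : t + ε ∈ Icc t (t + ε) := right_mem_Icc.2 (by linarith)
  have hB0 : 0 ≤ B := (norm_nonneg _).trans (hB t (hsub hleft))
  have h1 : ∀ r ∈ Icc t (t + ε), ‖γ r - γ t‖ ≤ B * ε := fun r hr => by
    refine ((convex_Icc t (t + ε)).norm_image_sub_le_of_norm_hasDerivWithin_le
      (fun x hx => (hγ x (hsub hx)).mono hsub) (fun x hx => hB x (hsub hx)) hleft hr).trans ?_
    gcongr
    rw [Real.norm_of_nonneg (by linarith [hr.1])]
    linarith [hr.2]
  have h2 := (convex_Icc t (t + ε)).norm_image_sub_le_of_norm_hasDerivWithin_le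
    (f := fun r => γ r - r • X (γ t)) (f' := fun r => X (γ r) - X (γ t)) (C := L * (B * ε))
    (fun x hx => by
      have h := ((hγ x (hsub hx)).mono hsub).sub
        ((hasDerivWithinAt_id x _).smul_const (X (γ t)))
      rw [one_smul] at h
      exact h)
    (fun x hx => (hL.norm_sub_le (hs x (hsub hx)) (hs t (hsub hleft))).trans (by
      gcongr
      exact h1 x hx)) hleft hright
  have heq : γ (t + ε) - (γ t + ε • X (γ t)) =
      γ (t + ε) - (t + ε) • X (γ t) - (γ t - t • X (γ t)) := by
    rw [add_smul]
    abel
  rw [heq]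
  refine h2.trans (le_of_eq ?_)
  rw [add_sub_cancel_left, Real.norm_of_nonneg hε]
  ring

/-- Uniform convergence of the perturbed Euler scheme on compact sets. -/
theorem IsSemiflow.exists_euler_dist_le [FiniteDimensional ℝ V] {X : V → V}
    (hX : ContDiff ℝ 1 X) {T : ℝ} {φ : ℝ → V → V} (hφ : IsSemiflow X T φ)
    {K U : Set V} (hK : IsCompact K) (hU : IsOpen U)
    (hKU : ∀ t ∈ Icc 0 T, ∀ z ∈ K, φ t z ∈ U) {c₀ : ℝ} (hc₀ : 0 < c₀) :
    ∃ ε₀ > 0, ∃ c₁ > 0, ∀ ε, 0 < ε → ε < ε₀ → ∀ u : V → V,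
      (∀ z ∈ U, ‖u z - ε • X z‖ ≤ c₀ * ε ^ 2) → ∀ m : ℕ, m * ε ≤ T → ∀ z ∈ K,
        ‖(fun y => y + u y)^[m] z - φ (m * ε) z‖ ≤ c₁ * ε := by
  have : ProperSpace V := FiniteDimensional.proper ℝ V
  have hK₁ := hφ.isCompact_image hX hK
  set K₁ := (fun p : ℝ × V => φ p.1 p.2) '' (Icc 0 T ×ˢ K)
  have hmem : ∀ t ∈ Icc 0 T, ∀ z ∈ K, φ t z ∈ K₁ := fun t ht z hz => ⟨(t, z), ⟨ht, hz⟩, rfl⟩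
  have hK₁U : K₁ ⊆ U := by
    rintro _ ⟨⟨t, z⟩, ⟨ht, hz⟩, rfl⟩
    exact hKU t ht z hz
  obtain ⟨δ, hδ, hδU⟩ := hK₁.exists_cthickening_subset_open hU hK₁U
  obtain ⟨R, hR⟩ := hK₁.isBounded.exists_norm_le
  obtain ⟨B₀, hB₀⟩ := hK₁.exists_bound_of_continuousOn hX.continuous.continuousOn
  obtain ⟨L, hL, -⟩ := exists_lipschitzOnWith_closedBall hX (R + δ)
  set B := max B₀ 0
  have hB : ∀ x ∈ K₁, ‖X x‖ ≤ B := fun x hx => (hB₀ x hx).trans (le_max_left _ _)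
  have hB0 : 0 ≤ B := le_max_right _ _
  set b := c₀ + L * B
  have hb : 0 < b := by positivity
  set c₁ := b * (|T| + 1) * Real.exp (L * T)
  have hc₁ : 0 < c₁ := by positivity
  refine ⟨δ / c₁, by positivity, c₁, hc₁, fun ε hε hεε u hu m hm z hz => ?_⟩
  have hc₁δ : c₁ * ε ≤ δ := by
    rw [lt_div_iff₀ hc₁] at hεε
    linarith
  have hle : ∀ m : ℕ, m * ε ≤ T →
      b * ε * (m * ε) * Real.exp (L * (m * ε)) ≤ c₁ * ε := fun m hm => by
    have : c₁ * ε = b * ε * (|T| + 1) * Real.exp (L * T) := by ring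
    rw [this]
    gcongr
    exact hm.trans ((le_abs_self T).trans (by linarith))
  refine le_trans ?_ (hle m hm)
  induction m with
  | zero => simp [(hφ z).1]
  | succ m ih =>
    push_cast at hm ⊢
    have hm' : m * ε ≤ T := by linarith
    have ht : m * ε ∈ Icc 0 T := ⟨by positivity, hm'⟩
    specialize ih hm'
    rw [Function.iterate_succ_apply']
    set w := (fun y => y + u y)^[m] z
    set p := φ (m * ε) z
    have hp : p ∈ K₁ := hmem _ ht z hz
    have hwp : ‖w - p‖ ≤ δ := ih.trans ((hle m hm').trans hc₁δ)
    have hwU : w ∈ U := hδU (mem_cthickening_of_dist_le w p δ K₁ hp (by rwa [dist_eq_norm]))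
    have hpR : p ∈ closedBall (0 : V) (R + δ) := by
      rw [mem_closedBall_zero_iff]
      linarith [hR p hp]
    have hwR : w ∈ closedBall (0 : V) (R + δ) := by
      rw [mem_closedBall_zero_iff]
      linarith [hR p hp, norm_le_norm_add_norm_sub' w p]
    have hstep : ‖φ ((m + 1) * ε) z - (p + ε • X p)‖ ≤ L * B * ε ^ 2 := by
      rw [add_one_mul]
      exact (hφ z).2.norm_euler_step_le (s := closedBall 0 (R + δ))
        (fun t ht => by
          rw [mem_closedBall_zero_iff]
          linarith [hR _ (hmem t ht z hz)]) hL
        (fun t ht => hB _ (hmem t ht z hz)) ht.1 hε.le (by linarith)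
    have hlip : ‖X w - X p‖ ≤ L * ‖w - p‖ := hL.norm_sub_le hwR hpR
    have hsplit : w + u w - φ ((m + 1) * ε) z = (w - p) + ε • (X w - X p) +
        (u w - ε • X w) - (φ ((m + 1) * ε) z - (p + ε • X p)) := by
      rw [smul_sub]
      abel
    have hexp : (1 + ε * L) * Real.exp (L * (m * ε)) ≤ Real.exp (L * ((m + 1) * ε)) := by
      have h1 : L * ((m + 1) * ε) = ε * L + L * (m * ε) := by ring
      rw [h1, Real.exp_add]
      gcongr
      linarith [Real.add_one_le_exp (ε * L)]
    have hexp1 : 1 ≤ Real.exp (L * ((m + 1) * ε)) := Real.one_le_exp (by positivity)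
    calc ‖w + u w - φ ((m + 1) * ε) z‖
        ≤ ‖w - p‖ + ε * (L * ‖w - p‖) + c₀ * ε ^ 2 + L * B * ε ^ 2 := by
          rw [hsplit]
          refine (norm_sub_le _ _).trans (add_le_add ((norm_add_le _ _).trans
            (add_le_add ((norm_add_le _ _).trans (add_le_add le_rfl ?_)) (hu w hwU))) hstep)
          rw [norm_smul, Real.norm_of_nonneg hε.le]
          gcongr
      _ = (1 + ε * L) * ‖w - p‖ + b * ε ^ 2 := by ring
      _ ≤ (1 + ε * L) * (b * ε * (m * ε) * Real.exp (L * (m * ε))) + b * ε ^ 2 := by gcongr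
      _ = b * ε * (m * ε) * ((1 + ε * L) * Real.exp (L * (m * ε))) + b * ε ^ 2 * 1 := by ring
      _ ≤ b * ε * (m * ε) * Real.exp (L * ((m + 1) * ε)) +
          b * ε ^ 2 * Real.exp (L * ((m + 1) * ε)) := by gcongr
      _ = b * ε * ((m + 1) * ε) * Real.exp (L * ((m + 1) * ε)) := by ring

/-- Convergence of the perturbed Euler scheme in the `C^k` topology, uniformly on compact sets. -/
theorem IsSemiflow.exists_euler_iteratedFDeriv_le.{u} (k : ℕ) :
    ∀ {V : Type u} [NormedAddCommGroup V] [NormedSpace ℝ V] [FiniteDimensional ℝ V] {X : V → V},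
    ContDiff ℝ (k + 1 : ℕ) X → ∀ {T : ℝ} {φ : ℝ → V → V}, IsSemiflow X T φ →
    ∀ {K U : Set V}, IsCompact K → IsOpen U → (∀ t ∈ Icc 0 T, ∀ z ∈ K, φ t z ∈ U) →
    ∀ {c₀ : ℝ}, 0 < c₀ → ∃ ε₀ > 0, ∃ c₁ > 0, ∀ ε, 0 < ε → ε < ε₀ →
      ∀ u : V → V, ContDiff ℝ k u →
      (∀ z ∈ U, ∀ i ≤ k, ‖iteratedFDeriv ℝ i (fun w => u w - ε • X w) z‖ ≤ c₀ * ε ^ 2) →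
      ∀ m : ℕ, m * ε ≤ T → ∀ z ∈ K, ∀ i ≤ k,
        ‖iteratedFDeriv ℝ i (fun w => (fun y => y + u y)^[m] w - φ (m * ε) w) z‖ ≤ c₁ * ε := by
  induction k with
  | zero =>
    intro V _ _ _ X hX T φ hφ K U hK hU hKU c₀ hc₀
    obtain ⟨ε₀, hε₀, c₁, hc₁, h⟩ := hφ.exists_euler_dist_le (by simpa using hX) hK hU hKU hc₀
    refine ⟨ε₀, hε₀, c₁, hc₁, fun ε hε hεε u _ hu m hm z hz i hi => ?_⟩
    obtain rfl := Nat.le_zero.1 hi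
    rw [norm_iteratedFDeriv_zero]
    exact h ε hε hεε u (fun z hz => by simpa using hu z hz 0 le_rfl) m hm z hz
  | succ k ih =>
    intro V _ _ _ X hX T φ hφ K U hK hU hKU c₀ hc₀
    have : ProperSpace V := FiniteDimensional.proper ℝ V
    rcases lt_or_ge T 0 with hT | hT
    · exact ⟨1, one_pos, 1, one_pos, fun ε hε _ u _ _ m hm =>
        absurd (hm.trans_lt hT) (not_lt.2 (by positivity))⟩
    have hX1 : ContDiff ℝ 1 X := hX.of_le (by norm_cast; omega)
    have hTX : ContDiff ℝ (k + 1 : ℕ) (tangentLift X) := hX.contDiff_tangentLift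
    have hTφ := hφ.isSemiflow_tangentLift hX1 hT
    have hTK : IsCompact (K ×ˢ closedBall (0 : V) 1) := hK.prod (isCompact_closedBall _ _)
    obtain ⟨R, hRpos, hR⟩ := (hTφ.isCompact_image
      (hTX.of_le (by norm_cast; omega)) hTK).isBounded.exists_pos_norm_le
    have hTKU : ∀ t ∈ Icc 0 T, ∀ p ∈ K ×ˢ closedBall (0 : V) 1,
        tangentLift (φ t) p ∈ U ×ˢ ball (0 : V) (R + 1) := fun t ht p hp => by
      refine ⟨hKU t ht _ hp.1, ?_⟩
      have h1 := (norm_snd_le _).trans (hR _ ⟨(t, p), ⟨ht, hp⟩, rfl⟩)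
      rw [mem_ball_zero_iff]
      linarith
    obtain ⟨ε₁, hε₁, c₁, hc₁, h₁⟩ := ih hTX hTφ hTK (hU.prod isOpen_ball) hTKU
      (c₀ := c₀ * (2 ^ k * (R + 1 + 1))) (by positivity)
    obtain ⟨ε₂, hε₂, c₂, hc₂, h₂⟩ := hφ.exists_euler_dist_le hX1 hK hU hKU hc₀
    refine ⟨min ε₁ ε₂, lt_min hε₁ hε₂, max c₁ c₂, lt_max_of_lt_left hc₁,
      fun ε hε hεε u hu hbd m hm z hz i hi => ?_⟩
    have hu1 : ContDiff ℝ 1 u := hu.of_le (by norm_cast; omega)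
    have hXk : ContDiff ℝ (k + 1 : ℕ) X := hX.of_le (by norm_cast; omega)
    have hεX : ContDiff ℝ (k + 1 : ℕ) fun w => ε • X w := hXk.const_smul ε
    have ht : m * ε ∈ Icc 0 T := ⟨by positivity, hm⟩
    cases i with
    | zero =>
      rw [norm_iteratedFDeriv_zero]
      refine (h₂ ε hε (hεε.trans_le (min_le_right _ _)) u (fun z hz => ?_) m hm z hz).trans ?_
      · simpa using hbd z hz 0 (Nat.zero_le _)
      · gcongr
        exact le_max_right _ _
    | succ i =>
      have hiter := contDiff_iterate (contDiff_id_add hu) m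
      have hflow := IsSemiflow.contDiff (k + 1) hX hφ _ ht
      have hTdiff : tangentLift (fun w => (fun y => y + u y)^[m] w - φ (m * ε) w) =
          fun p => (fun q => q + tangentLift u q)^[m] p - tangentLift (φ (m * ε)) p := by
        rw [tangentLift_sub (hiter.differentiable (by simp)) (hflow.differentiable (by simp)),
          tangentLift_iterate_id_add hu1]
      have hTu : tangentLift (fun w => u w - ε • X w) =
          fun p => tangentLift u p - ε • tangentLift X p := by
        rw [tangentLift_sub (hu1.differentiable one_ne_zero)
          (hεX.differentiable (by simp)),
          tangentLift_const_smul (hX1.differentiable one_ne_zero)]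
      refine norm_iteratedFDeriv_succ_le_of_tangentLift
        ((hiter.sub hflow).of_le (by norm_cast)) (by positivity) fun v hv => ?_
      rw [hTdiff]
      refine (h₁ ε hε (hεε.trans_le (min_le_left _ _)) _ hu.contDiff_tangentLift
        (fun p hp j hj => ?_) m hm (z, v) ⟨hz, hv⟩ i (by omega)).trans ?_
      · rw [← hTu]
        refine (norm_iteratedFDeriv_tangentLift_le hj (hu.sub hεX)
          (hbd p.1 hp.1) p.2).trans ?_
        have : ‖p.2‖ ≤ R + 1 := (mem_ball_zero_iff.1 hp.2).le
        calc c₀ * ε ^ 2 * (2 ^ k * (‖p.2‖ + 1)) ≤ c₀ * ε ^ 2 * (2 ^ k * (R + 1 + 1)) := by gcongr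
          _ = c₀ * (2 ^ k * (R + 1 + 1)) * ε ^ 2 := by ring
      · gcongr
        exact le_max_left _ _

lemma iterate_id_add_add_right {W : Type*} [AddCommGroup W] {u : W → W} {a : W}
    (hu : ∀ w, u (w + a) = u w) (m : ℕ) (w : W) :
    (fun y => y + u y)^[m] (w + a) = (fun y => y + u y)^[m] w + a :=
  (Function.Semiconj.iterate_right (f := (· + a)) (fun w => by simp only [hu]; abel) m w).symm

lemma IsSemiflow.apply_add_right [FiniteDimensional ℝ V] {X : V → V} (hX : ContDiff ℝ 1 X)
    {T : ℝ} {φ : ℝ → V → V} (hφ : IsSemiflow X T φ) {a : V} (ha : ∀ w, X (w + a) = X w)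
    {t : ℝ} (ht : t ∈ Icc 0 T) (w : V) : φ t (w + a) = φ t w + a := by
  have hsol : SolvesOn X T fun t => φ t w + a := fun t ht => by
    simpa only [ha] using ((hφ w).2 t ht).add_const a
  exact hsol.eqOn hX (hφ (w + a)).2 (by simp only [(hφ _).1]) t ht

end FlowRegularity

/-- Convergence of the Euler scheme, uniformly in the `Cᵏ` topology: if
`X` is a `C^{k+1}` `ℤⁿ`-periodic vector field with complete flow `φ̃` leaving a closed set
`K̃` invariant, then for every `c₀ > 0` there are `ε₀, c₁ > 0` such that, for any
`ε ∈ (0, ε₀)` and any `Cᵏ` periodic map `u` with `‖u - εX‖_{Cᵏ(Ũ)} ≤ c₀ ε²`, one has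
`‖(id + u)^m − φ̃_{mε}‖_{Cᵏ(K̃)} ≤ c₁ ε` whenever `mε ≤ c₀`. -/
theorem euler_scheme_estimate (n k : ℕ) (hk : 1 ≤ k)
    (X : E n × E n → E n × E n) (hX : ContDiff ℝ ((k + 1 : ℕ) : ℕ∞) X)
    (hXper : ∀ (x p : E n) (m : Fin n → ℤ), X (x + intVec m, p) = X (x, p))
    (φ : ℝ → E n × E n → E n × E n)
    (hφ0 : ∀ z : E n × E n, φ 0 z = z)
    (hφ : ∀ (z : E n × E n) (t : ℝ), HasDerivAt (fun s => φ s z) (X (φ t z)) t)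
    (K U : Set (E n × E n)) (hKclosed : IsClosed K) (hUopen : IsOpen U) (hKU : K ⊆ U)
    (hKper : ∀ z ∈ K, ∀ m : Fin n → ℤ, (z.1 + intVec m, z.2) ∈ K)
    (hUper : ∀ z ∈ U, ∀ m : Fin n → ℤ, (z.1 + intVec m, z.2) ∈ U)
    (hUbd : ∃ R : ℝ, ∀ z ∈ U, ‖z.2‖ ≤ R)
    (hKinv : ∀ t : ℝ, ∀ z ∈ K, φ t z ∈ K) :
    ∀ c₀ : ℝ, 0 < c₀ → ∃ ε₀ : ℝ, 0 < ε₀ ∧ ∃ c₁ : ℝ, 0 < c₁ ∧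
      ∀ ε : ℝ, 0 < ε → ε < ε₀ →
        ∀ u : E n × E n → E n × E n, ContDiff ℝ (k : ℕ∞) u →
          (∀ (x p : E n) (m : Fin n → ℤ), u (x + intVec m, p) = u (x, p)) →
          (∀ z ∈ U, ∀ i : ℕ, i ≤ k →
            ‖iteratedFDeriv ℝ i (fun w => u w - ε • X w) z‖ ≤ c₀ * ε ^ 2) →
          ∀ m : ℕ, (m : ℝ) * ε ≤ c₀ →
            ∀ z ∈ K, ∀ i : ℕ, i ≤ k →
              ‖iteratedFDeriv ℝ i
                (fun w => (fun y => y + u y)^[m] w - φ ((m : ℝ) * ε) w) z‖ ≤ c₁ * ε := by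
  intro c₀ hc₀
  have hXk : ContDiff ℝ (k + 1 : ℕ) X := by exact_mod_cast hX
  have hflow : IsSemiflow X c₀ φ := fun z => ⟨hφ0 z, fun t _ => (hφ z t).hasDerivWithinAt⟩
  obtain ⟨R, hR⟩ := hUbd
  have hK₀ : IsCompact (K ∩ Set.Icc 0 1 ×ˢ Metric.closedBall 0 R) :=
    (isCompact_Icc.prod (isCompact_closedBall _ _)).inter_left hKclosed
  obtain ⟨ε₀, hε₀, c₁, hc₁, h⟩ := hflow.exists_euler_iteratedFDeriv_le k hXk hK₀ hUopen
    (fun t _ z hz => hKU (hKinv t z hz.1)) hc₀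
  refine ⟨ε₀, hε₀, c₁, hc₁, fun ε hε hεε u hu huper hbd m hm z hz i hi => ?_⟩
  set a : E n × E n := (intVec fun j => -⌊z.1 j⌋, 0) with ha
  have hadd : ∀ w, w + a = (w.1 + intVec fun j => -⌊z.1 j⌋, w.2) := fun w => by
    rw [ha, Prod.add_def, add_zero]
  have hza : z + a ∈ K ∩ Set.Icc 0 1 ×ˢ Metric.closedBall 0 R := by
    rw [hadd]
    refine ⟨hKper z hz _, ⟨fun j => ?_, fun j => ?_⟩, ?_⟩
    · simp [intVec, ← sub_eq_add_neg]
    · simpa [intVec, ← sub_eq_add_neg] using (Int.fract_lt_one (z.1 j)).le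
    · simpa using hR z (hKU hz)
  have hper : ∀ w, (fun y => y + u y)^[m] (w + a) - φ (m * ε) (w + a) =
      (fun y => y + u y)^[m] w - φ (m * ε) w := fun w => by
    rw [iterate_id_add_add_right (fun w => by rw [hadd, huper]),
      hflow.apply_add_right (hXk.of_le (by norm_cast; omega)) (fun w => by rw [hadd, hXper])
        ⟨by positivity, hm⟩, add_sub_add_right_eq_sub]
  have key := h ε hε hεε u (by exact_mod_cast hu) hbd m hm (z + a) hza i hi
  rw [← iteratedFDeriv_comp_add_right] at key
  simpa only [hper] using key

end
end

section
/- Let H be a C^k (k ≥ 2) Tonelli Hamiltonian on T*𝕋ⁿ that is C⁰ integrable. Then the set Σ = {(x,p) ∈ ℝⁿ × ℝⁿ : ∂H/∂p(x,p) = 0} is the graph of a C^{k−1}, ℤⁿ-periodic map σ : ℝⁿ → ℝⁿ; every point of Σ is a critical point of H (i.e. also ∂H/∂x = 0 there, so every point of Σ is a fixed point of the Hamiltonian flow); and the Jacobian matrix Dσ(x) is symmetric at every x, so that Σ is a C^{k−1} Lagrangian graph. -/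
open MeasureTheory Filter
open scoped NNReal

noncomputable section

/-- `H` is `C⁰` integrable: the phase space is partitioned by invariant Lipschitz
Lagrangian graphs `{(x, c + ∇u_c x)}`, `c ∈ ℝⁿ`. -/
def C0Integrable (n : ℕ) (H : E n × E n → ℝ) (φ : ℝ → E n × E n → E n × E n) : Prop :=
  ∃ F : E n × E n → E n,
    (∀ c : E n, ∃ u : E n → ℝ, ContDiff ℝ 1 u ∧
      (∀ (x : E n) (m : Fin n → ℤ), u (x + intVec m) = u x) ∧
      (∃ K : ℝ≥0, LipschitzWith K (gradF n u)) ∧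
      ∀ x : E n, F (x, c) = c + gradF n u x) ∧
    (∀ (c : E n) (t : ℝ) (x : E n),
      (φ t (x, F (x, c))).2 = F ((φ t (x, F (x, c))).1, c)) ∧
    (∀ z : E n × E n, ∃! c : E n, z.2 = F (z.1, c))

/-- A locally Lipschitz function whose derivative vanishes almost everywhere is constant. -/
theorem LocallyLipschitz.eq_of_ae_hasFDerivAt_zero {V : Type*} [NormedAddCommGroup V]
    [NormedSpace ℝ V] [MeasurableSpace V] [BorelSpace V] [FiniteDimensional ℝ V]
    (μ : Measure V) [μ.IsAddHaarMeasure] {g : V → ℝ} (hg : LocallyLipschitz g)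
    (h : ∀ᵐ y ∂μ, HasFDerivAt g (0 : V →L[ℝ] ℝ) y) (x y : V) : g x = g y := by
  have key : ∀ v : V, ∀ᵐ x ∂μ, g (x + v) = g x := by
    intro v
    obtain ⟨N, hN, hNm, hN0⟩ := exists_measurable_superset_of_null (ae_iff.1 h)
    have h1 : ∀ t : ℝ, ∀ᵐ x ∂μ, x + t • v ∈ Nᶜ := fun t =>
      (measurePreserving_add_right μ (t • v)).quasiMeasurePreserving.ae
        (p := fun y => y ∈ Nᶜ) (compl_mem_ae_iff.2 hN0)
    have h2 : ∀ᵐ x ∂μ, ∀ᵐ t : ℝ, x + t • v ∈ Nᶜ := by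
      refine (Measure.ae_ae_comm ?_).2 (ae_of_all _ h1)
      have hm : Measurable (fun z : V × ℝ => z.1 + z.2 • v) := by
        have : Continuous (fun z : V × ℝ => z.1 + z.2 • v) := by fun_prop
        exact this.measurable
      exact hm hNm.compl
    filter_upwards [h2] with x hx
    have hline : LocallyLipschitz (fun t : ℝ => g (x + t • v)) := by
      have : ContDiff ℝ 1 (fun t : ℝ => x + t • v) := by fun_prop
      exact hg.comp this.locallyLipschitz
    obtain ⟨K, hK⟩ := (hline.locallyLipschitzOn
      (s := Set.uIcc (0 : ℝ) 1)).exists_lipschitzOnWith_of_compact isCompact_uIcc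
    have hFTC := hK.absolutelyContinuousOnInterval.integral_deriv_eq_sub
    have hzero : ∀ᵐ t : ℝ, deriv (fun t : ℝ => g (x + t • v)) t = 0 := by
      filter_upwards [hx] with t ht
      have h3 : HasFDerivAt g (0 : V →L[ℝ] ℝ) (x + t • v) := by
        by_contra hc
        exact ht (hN hc)
      have h4 : HasDerivAt (fun t : ℝ => x + t • v) v t := by
        simpa using ((hasDerivAt_id t).smul_const v).const_add x
      exact (h3.comp_hasDerivAt t h4).deriv.trans rfl
    rw [intervalIntegral.integral_congr_ae (g := fun _ => (0 : ℝ))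
      (by filter_upwards [hzero] with t ht _ using ht)] at hFTC
    simp at hFTC
    linarith
  have hcont : Continuous (fun z => g (z + (x - y))) := hg.continuous.comp (by fun_prop)
  have := (hcont.ae_eq_iff_eq μ hg.continuous).1 (key (x - y))
  simpa using congrFun this y

theorem clm_apply_eq_dotP {n : ℕ} (L : E n →L[ℝ] ℝ) (v : E n) :
    L v = dotP n (fun i => L (Pi.single i 1)) v := by
  conv_lhs => rw [← Finset.univ_sum_single v]
  rw [map_sum]
  refine Finset.sum_congr rfl fun i _ => ?_
  rw [show (Pi.single i (v i) : E n) = v i • Pi.single i 1 by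
    rw [← Pi.single_smul, smul_eq_mul, mul_one], map_smul, smul_eq_mul, mul_comm]

theorem fderiv_apply_eq_dotP_gradF {n : ℕ} (u : E n → ℝ) (x v : E n) :
    fderiv ℝ u x v = dotP n (gradF n u x) v :=
  clm_apply_eq_dotP _ _

/-- The pairing with a vector, as a continuous linear map into the dual. -/
def dotCLM (n : ℕ) : E n →L[ℝ] E n →L[ℝ] ℝ :=
  ∑ i, (ContinuousLinearMap.proj (R := ℝ) (φ := fun _ : Fin n => ℝ) i).smulRight
    (ContinuousLinearMap.proj (R := ℝ) (φ := fun _ : Fin n => ℝ) i)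

theorem dotCLM_apply {n : ℕ} (a b : E n) : dotCLM n a b = dotP n a b := by
  simp [dotCLM, dotP]

theorem dotP_comm {n : ℕ} (a b : E n) : dotP n a b = dotP n b a :=
  Finset.sum_congr rfl fun _ _ => mul_comm _ _

/-- The derivative of a gradient is symmetric wherever it exists. -/
theorem dotP_fderiv_gradF_symm {n : ℕ} {u : E n → ℝ} (hu : Differentiable ℝ u) {x : E n}
    {D : E n →L[ℝ] E n} (hD : HasFDerivAt (gradF n u) D x) (v w : E n) :
    dotP n (D v) w = dotP n (D w) v := by
  have h1 : ∀ y, HasFDerivAt u (dotCLM n (gradF n u y)) y := by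
    intro y
    convert (hu y).hasFDerivAt using 1
    ext1 v
    rw [dotCLM_apply, fderiv_apply_eq_dotP_gradF]
  have h2 := second_derivative_symmetric h1 ((dotCLM n).hasFDerivAt.comp x hD) v w
  simpa [dotCLM_apply] using h2

theorem fderiv_hamiltonian_apply {n : ℕ} {H : E n × E n → ℝ} (hH : Differentiable ℝ H)
    (z v : E n × E n) :
    fderiv ℝ H z v = dotP n (gradX n H z.1 z.2) v.1 + dotP n (gradP n H z.1 z.2) v.2 := by
  have hx : HasFDerivAt (fun x' => H (x', z.2)) ((fderiv ℝ H z).comp (.inl ℝ (E n) (E n))) z.1 :=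
    (hH z).hasFDerivAt.comp z.1 (hasFDerivAt_prodMk_left z.1 z.2)
  have hp : HasFDerivAt (fun p' => H (z.1, p')) ((fderiv ℝ H z).comp (.inr ℝ (E n) (E n))) z.2 :=
    (hH z).hasFDerivAt.comp z.2 (hasFDerivAt_prodMk_right z.1 z.2)
  have e1 := clm_apply_eq_dotP (fderiv ℝ (fun x' => H (x', z.2)) z.1) v.1
  have e2 := clm_apply_eq_dotP (fderiv ℝ (fun p' => H (z.1, p')) z.2) v.2
  have : v = (v.1, 0) + (0, v.2) := by simp
  rw [show dotP n (gradX n H z.1 z.2) v.1 = _ from e1.symm,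
    show dotP n (gradP n H z.1 z.2) v.2 = _ from e2.symm, hx.fderiv, hp.fderiv]
  conv_lhs => rw [this, map_add]
  rfl

/-- `H` is constant on a Lipschitz Lagrangian graph invariant under its flow. -/
theorem hamiltonian_const_on_invariant_graph {n : ℕ} {H : E n × E n → ℝ} (hH : ContDiff ℝ 1 H)
    {φ : ℝ → E n × E n → E n × E n} (hφ : IsHamFlow n H φ) {c : E n} {u : E n → ℝ}
    (hu : Differentiable ℝ u) {K : ℝ≥0} (hK : LipschitzWith K (gradF n u))
    (hinv : ∀ (t : ℝ) (x : E n), (φ t (x, c + gradF n u x)).2 =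
      c + gradF n u (φ t (x, c + gradF n u x)).1) (x y : E n) :
    H (x, c + gradF n u x) = H (y, c + gradF n u y) := by
  have hHd : Differentiable ℝ H := hH.differentiable one_ne_zero
  have hlip : LocallyLipschitz (fun x => H (x, c + gradF n u x)) := by
    refine hH.locallyLipschitz.comp (f := H) (g := fun x => (x, c + gradF n u x)) ?_
    have : LocallyLipschitz (fun x => c + gradF n u x) :=
      LocallyLipschitz.comp (f := fun z : E n => c + z)
        (LipschitzWith.of_dist_le_mul (K := 1) (by simp)).locallyLipschitz hK.locallyLipschitz
    exact LocallyLipschitz.prodMk LocallyLipschitz.id this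
  refine hlip.eq_of_ae_hasFDerivAt_zero volume ?_ x y
  filter_upwards [hK.ae_differentiableAt (μ := volume)] with x hx
  set D := fderiv ℝ (gradF n u) x
  have hD : HasFDerivAt (gradF n u) D x := hx.hasFDerivAt
  set z : E n × E n := (x, c + gradF n u x)
  have hgraph : HasFDerivAt (fun x => (x, c + gradF n u x))
      ((ContinuousLinearMap.id ℝ (E n)).prod D) x :=
    (hasFDerivAt_id x).prodMk (hD.const_add c)
  have hder := (hHd z).hasFDerivAt.comp x hgraph
  have hflow := hφ.2 z 0
  rw [hφ.1] at hflow
  have hfst : HasDerivAt (fun s => (φ s z).1) (gradP n H z.1 z.2) 0 := hflow.fst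
  have hsnd : HasDerivAt (fun s => (φ s z).2) (-gradX n H z.1 z.2) 0 := hflow.snd
  have hfst' : HasDerivAt (fun s => c + gradF n u (φ s z).1) (D (gradP n H z.1 z.2)) 0 := by
    refine HasDerivAt.const_add c ?_
    refine HasFDerivAt.comp_hasDerivAt (0 : ℝ) (l := gradF n u) ?_ hfst
    rw [hφ.1]
    exact hD
  have hX : -gradX n H z.1 z.2 = D (gradP n H z.1 z.2) :=
    hsnd.unique (hfst'.congr_of_eventuallyEq (Eventually.of_forall fun s => hinv s x))
  suffices hzero : (fderiv ℝ H z).comp ((ContinuousLinearMap.id ℝ (E n)).prod D) = 0 by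
    rw [hzero] at hder
    exact hder
  ext1 v
  have hs := dotP_fderiv_gradF_symm hu hD (gradP n H z.1 z.2) v
  rw [← hX] at hs
  simp only [ContinuousLinearMap.comp_apply, ContinuousLinearMap.prod_apply,
    ContinuousLinearMap.id_apply, fderiv_hamiltonian_apply hHd, zero_apply]
  rw [dotP_comm (gradP n H z.1 z.2), ← hs]
  simp [dotP, Finset.sum_neg_distrib]

section Fiber

variable {n : ℕ} {k : ℕ∞} {H : E n × E n → ℝ}

theorem gradP_eq_zero_iff (H : E n × E n → ℝ) (x p : E n) :
    gradP n H x p = 0 ↔ fderiv ℝ (fun p' => H (x, p')) p = 0 := by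
  constructor
  · intro h
    ext1 v
    refine (clm_apply_eq_dotP _ v).trans ?_
    change dotP n (gradP n H x p) v = 0
    simp [h, dotP]
  · intro h
    funext i
    simp [gradP, h]

theorem IsTonelliHamiltonian.contDiff_fiber (hH : IsTonelliHamiltonian n k H) (x : E n) :
    ContDiff ℝ k (fun p => H (x, p)) :=
  hH.smooth.comp (contDiff_prodMk_right x)

theorem IsTonelliHamiltonian.exists_isMin (hH : IsTonelliHamiltonian n k H) (x : E n) :
    ∃ p, ∀ q, H (x, p) ≤ H (x, q) := by
  refine (hH.contDiff_fiber x).continuous.exists_forall_le ?_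
  obtain ⟨R, hR⟩ := hH.superlinear 1
  refine tendsto_atTop_mono' _ ?_ (tendsto_norm_cocompact_atTop (E := E n))
  filter_upwards [(tendsto_norm_cocompact_atTop (E := E n)).eventually_ge_atTop R] with p hp
  simpa using hR x p hp

theorem gradP_eq_zero_of_isMin {x p : E n} (h : ∀ q, H (x, p) ≤ H (x, q)) :
    gradP n H x p = 0 :=
  (gradP_eq_zero_iff H x p).2
    (IsLocalMin.fderiv_eq_zero (f := fun p => H (x, p)) (Eventually.of_forall h))

/-- The fiber derivative of a Tonelli Hamiltonian vanishes at most once in each fiber. -/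
theorem IsTonelliHamiltonian.gradP_eq_zero_unique (hH : IsTonelliHamiltonian n k H) (hk : 2 ≤ k)
    {x p q : E n} (hp : gradP n H x p = 0) (hq : gradP n H x q = 0) : p = q := by
  by_contra hne
  rw [gradP_eq_zero_iff] at hp hq
  set w := q - p with hw
  have hw0 : w ≠ 0 := sub_ne_zero.2 (Ne.symm hne)
  have hf : ContDiff ℝ (1 : ℕ∞) (fderiv ℝ (fun p' => H (x, p'))) :=
    (hH.contDiff_fiber x).fderiv_right (by exact_mod_cast one_add_one_eq_two.trans_le hk)
  have hd : Differentiable ℝ (fun p' => fderiv ℝ (fun p'' => H (x, p'')) p' w) :=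
    (hf.differentiable (by simp)).clm_apply (differentiable_const w)
  have hderiv : ∀ t : ℝ, HasDerivAt
      (fun t : ℝ => fderiv ℝ (fun p'' => H (x, p'')) (p + t • w) w)
      (fderiv ℝ (fun p' => fderiv ℝ (fun p'' => H (x, p'')) p' w) (p + t • w) w) t := by
    intro t
    have h4 : HasDerivAt (fun t : ℝ => p + t • w) w t := by
      simpa using ((hasDerivAt_id t).smul_const w).const_add p
    exact (hd (p + t • w)).hasFDerivAt.comp_hasDerivAt t h4
  have hmono := strictMono_of_deriv_pos fun t => by
    rw [(hderiv t).deriv]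
    exact hH.posdef x _ w hw0
  have := hmono (zero_lt_one (α := ℝ))
  simp [hw, hp, hq] at this

theorem gradP_apply_eq (hH : Differentiable ℝ H) (z : E n × E n) (i : Fin n) :
    gradP n H z.1 z.2 i = fderiv ℝ H z (0, Pi.single i 1) := by
  rw [fderiv_hamiltonian_apply hH]
  simp [dotP, Pi.single_apply]

theorem contDiff_gradP {m l : ℕ∞} (hH : ContDiff ℝ l H) (hml : m + 1 ≤ l) :
    ContDiff ℝ m (fun z : E n × E n => gradP n H z.1 z.2) := by
  have hd : Differentiable ℝ H := (hH.of_le (m := 1) (by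
    exact_mod_cast le_trans le_add_self hml)).differentiable one_ne_zero
  refine contDiff_pi.2 fun i => ?_
  simp only [gradP_apply_eq hd]
  exact (hH.fderiv_right (by exact_mod_cast hml)).clm_apply contDiff_const

theorem IsTonelliHamiltonian.isInvertible_fderiv_gradP (hH : IsTonelliHamiltonian n k H)
    (hk : 2 ≤ k) (z : E n × E n) :
    (fderiv ℝ (fun z : E n × E n => gradP n H z.1 z.2) z ∘L
      .inr ℝ (E n) (E n)).IsInvertible := by
  set A := fderiv ℝ (fun z : E n × E n => gradP n H z.1 z.2) z ∘L .inr ℝ (E n) (E n)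
  have hGd : DifferentiableAt ℝ (fun z : E n × E n => gradP n H z.1 z.2) z :=
    (contDiff_gradP (m := 1) hH.smooth (by rwa [one_add_one_eq_two])).differentiable
      (by simp) z
  have hG : HasFDerivAt (fun p => gradP n H z.1 p) A z.2 :=
    HasFDerivAt.comp (g := fun z : E n × E n => gradP n H z.1 z.2) (f := fun p => (z.1, p)) z.2
      hGd.hasFDerivAt (hasFDerivAt_prodMk_right z.1 z.2)
  have hquad : ∀ w, dotP n (A w) w =
      fderiv ℝ (fun p' => fderiv ℝ (fun p'' => H (z.1, p'')) p' w) z.2 w := by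
    intro w
    have h1 : (fun p' => fderiv ℝ (fun p'' => H (z.1, p'')) p' w) =
        fun p' => dotCLM n w (gradP n H z.1 p') := by
      funext p'
      rw [clm_apply_eq_dotP, dotCLM_apply, dotP_comm]
      rfl
    have h2 : HasFDerivAt (fun p' => dotCLM n w (gradP n H z.1 p')) ((dotCLM n w).comp A) z.2 :=
      (dotCLM n w).hasFDerivAt.comp z.2 hG
    rw [h1, h2.fderiv, dotP_comm]
    exact (dotCLM_apply w (A w)).symm
  have hinj : Function.Injective A := by
    refine (injective_iff_map_eq_zero A).2 fun w hw => ?_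
    by_contra hw0
    have := hH.posdef z.1 z.2 w hw0
    rw [← hquad, hw] at this
    simp [dotP] at this
  exact ⟨(LinearEquiv.ofInjectiveEndo (A : E n →ₗ[ℝ] E n) hinj).toContinuousLinearEquiv, by
    ext1 w; rfl⟩

/-- The zero set of the fiber derivative is a `C^{k-1}` graph. -/
theorem IsTonelliHamiltonian.contDiff_of_gradP_eq_zero (hH : IsTonelliHamiltonian n k H)
    (hk : 2 ≤ k) {m : ℕ∞} (hm : m ≠ 0) (hmk : m + 1 ≤ k) {σ : E n → E n}
    (hσ : ∀ x, gradP n H x (σ x) = 0) : ContDiff ℝ m σ := by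
  refine contDiff_iff_contDiffAt.2 fun x => ?_
  have cdf : ContDiffAt ℝ m (fun z : E n × E n => gradP n H z.1 z.2) (x, σ x) :=
    (contDiff_gradP hH.smooth hmk).contDiffAt
  have hm' : (m : WithTop ℕ∞) ≠ 0 := by exact_mod_cast hm
  have hinv := hH.isInvertible_fderiv_gradP hk (x, σ x)
  refine (cdf.contDiffAt_implicitFunction hm' hinv).congr_of_eventuallyEq ?_
  filter_upwards [cdf.eventually_apply_implicitFunction hm' hinv] with y hy
  exact hH.gradP_eq_zero_unique hk (hσ y) (hy.trans (hσ x))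

end Fiber

/-- For a `Cᵏ` (`k ≥ 2`) Tonelli Hamiltonian that is `C⁰` integrable,
the set `Σ = {(x, p) : ∂H/∂p (x, p) = 0}` is the graph of a `ℤⁿ`-periodic `C^{k-1}` map
`σ`, all its points are critical points of `H` (hence fixed points of the flow), and the
Jacobian of `σ` is symmetric everywhere, so that `Σ` is a `C^{k-1}` Lagrangian graph. -/
theorem critical_set_lagrangian_graph (n k : ℕ) (hn : 1 ≤ n) (hk : 2 ≤ k)
    (H : E n × E n → ℝ) (hH : IsTonelliHamiltonian n (k : ℕ∞) H)
    (φ : ℝ → E n × E n → E n × E n) (hφ : IsHamFlow n H φ)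
    (hint : C0Integrable n H φ) :
    ∃ σ : E n → E n,
      ContDiff ℝ ((k - 1 : ℕ) : ℕ∞) σ ∧
      (∀ (x : E n) (m : Fin n → ℤ), σ (x + intVec m) = σ x) ∧
      -- `Σ` is the graph of `σ`
      (∀ x p : E n, gradP n H x p = 0 ↔ p = σ x) ∧
      -- every point of `Σ` is a critical point of `H` ...
      (∀ x : E n, gradX n H x (σ x) = 0) ∧
      -- ... hence a fixed point of the Hamiltonian flow
      (∀ (t : ℝ) (x : E n), φ t (x, σ x) = (x, σ x)) ∧
      -- `Σ` is Lagrangian: the Jacobian of `σ` is symmetric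
      (∀ (x : E n) (i j : Fin n),
        fderiv ℝ (fun y => σ y i) x (Pi.single j 1) =
        fderiv ℝ (fun y => σ y j) x (Pi.single i 1)) := by
  have hk2 : (2 : ℕ∞) ≤ (k : ℕ∞) := by exact_mod_cast hk
  have hH1 : ContDiff ℝ 1 H := hH.smooth.of_le (by exact_mod_cast one_le_two.trans hk)
  obtain ⟨F, hF, hFinv, hFcover⟩ := hint
  have hconst : ∀ c x y, H (x, F (x, c)) = H (y, F (y, c)) := by
    intro c x y
    obtain ⟨u, hu, -, ⟨K, hK⟩, hFu⟩ := hF c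
    rw [hFu, hFu]
    refine hamiltonian_const_on_invariant_graph hH1 hφ (hu.differentiable one_ne_zero) hK ?_ x y
    intro t x
    rw [← hFu, ← hFu]
    exact hFinv c t x
  choose σ hmin using hH.exists_isMin
  have hcrit : ∀ x, gradP n H x (σ x) = 0 := fun x => gradP_eq_zero_of_isMin (hmin x)
  have hgraph : ∀ x p, gradP n H x p = 0 ↔ p = σ x := fun x p =>
    ⟨fun h => hH.gradP_eq_zero_unique hk2 h (hcrit x), fun h => h ▸ hcrit x⟩
  have hle : ∀ x y, H (y, σ y) ≤ H (x, σ x) := by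
    intro x y
    obtain ⟨c, hc, -⟩ := hFcover (x, σ x)
    calc H (y, σ y) ≤ H (y, F (y, c)) := hmin y _
      _ = H (x, F (x, c)) := hconst c y x
      _ = H (x, σ x) := by rw [← hc]
  obtain ⟨c, hc, -⟩ := hFcover (0, σ 0)
  have hσF : ∀ x, σ x = F (x, c) := by
    intro x
    refine ((hgraph x _).1 (gradP_eq_zero_of_isMin fun q => ?_)).symm
    calc H (x, F (x, c)) = H (0, F (0, c)) := hconst c x 0
      _ = H (0, σ 0) := by rw [← hc]
      _ ≤ H (x, σ x) := hle x 0
      _ ≤ H (x, q) := hmin x q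
  have hgradX : ∀ x, gradX n H x (σ x) = 0 := by
    intro x
    have h : IsLocalMin (fun x' => H (x', σ x)) x :=
      Eventually.of_forall fun y => (hle y x).trans (hmin y (σ x))
    funext i
    simp [gradX, h.fderiv_eq_zero]
  have hσ : ContDiff ℝ ((k - 1 : ℕ) : ℕ∞) σ := by
    refine hH.contDiff_of_gradP_eq_zero hk2 ?_ ?_ hcrit
    · exact_mod_cast (show k - 1 ≠ 0 by omega)
    · exact_mod_cast (show k - 1 + 1 ≤ k by omega)
  refine ⟨σ, hσ, ?_, hgraph, hgradX, ?_, ?_⟩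
  · intro x m
    refine (hgraph x _).1 (gradP_eq_zero_of_isMin fun q => ?_)
    rw [← hH.periodic x _ m, ← hH.periodic x q m]
    exact hmin _ _
  · intro t x
    have hzero : ∀ s, HasDerivAt (fun s => φ s (x, σ x)) 0 s := by
      intro s
      convert hφ.2 (x, σ x) s using 1
      have h2 : (φ s (x, σ x)).2 = σ (φ s (x, σ x)).1 := by
        rw [hσF, hσF]
        exact hFinv c s x
      simp [hamVF, h2, hcrit, hgradX, Prod.zero_eq_mk]
    have := is_const_of_deriv_eq_zero (fun s => (hzero s).differentiableAt)
      (fun s => (hzero s).deriv) t 0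
    simpa [hφ.1] using this
  · intro x i j
    obtain ⟨u, hu, -, -, hFu⟩ := hF c
    have hσd : HasFDerivAt σ (fderiv ℝ σ x) x :=
      (hσ.differentiable (by exact_mod_cast (show k - 1 ≠ 0 by omega)) x).hasFDerivAt
    have hgrad : HasFDerivAt (gradF n u) (fderiv ℝ σ x) x := by
      refine (hσd.sub_const c).congr_of_eventuallyEq (Eventually.of_forall fun y => ?_)
      simp [hσF, hFu]
    have hs := dotP_fderiv_gradF_symm (hu.differentiable one_ne_zero) hgrad
      (Pi.single i 1) (Pi.single j 1)
    rw [(hasFDerivAt_pi'.1 hσd i).fderiv, (hasFDerivAt_pi'.1 hσd j).fderiv]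
    simpa [dotP, Pi.single_apply] using hs.symm

end
end
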